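/- arXiv:2112.08568 — 2 statements merged into one kernel-verified Lean document; each statement's English description precedes it below -/
import Mathlib

section
/- First Barnes Lemma: Let α, β, γ, δ ∈ ℂ and let σ ∈ ℝ satisfy max(−Re α, −Re β) < σ < min(Re γ, Re δ). Then (1/(2π)) ∫_ℝ Γ(σ+it+α) Γ(σ+it+β) Γ(γ−σ−it) Γ(δ−σ−it) dt = Γ(α+γ) Γ(α+δ) Γ(β+γ) Γ(β+δ) / Γ(α+β+γ+δ). -/
open Complex MeasureTheory
open scoped FourierTransform

/-- The Gamma function at `s` is bounded by its value at the real part of `s`. -/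
theorem norm_Gamma_le_Gamma_re {s : ℂ} (hs : 0 < s.re) : ‖Gamma s‖ ≤ Real.Gamma s.re := by
  rw [Gamma_eq_integral hs, Real.Gamma_eq_integral hs, GammaIntegral]
  refine (norm_integral_le_integral_norm _).trans_eq ?_
  refine setIntegral_congr_fun measurableSet_Ioi fun x hx ↦ ?_
  have hx : 0 < x := hx
  simp only [norm_mul, norm_real, Real.norm_of_nonneg (Real.exp_pos _).le,
    norm_cpow_eq_rpow_re_of_pos hx, sub_re, one_re]

theorem integrable_inv_sq_add_sq {p : ℝ} (hp : 0 < p) (q : ℝ) :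
    Integrable fun t : ℝ ↦ (p ^ 2 + (t + q) ^ 2)⁻¹ := by
  have h := ((integrable_inv_one_add_sq.comp_div hp.ne').comp_add_right q).const_mul (p ^ 2)⁻¹
  refine h.congr (.of_forall fun t ↦ ?_)
  simp only
  rw [← mul_inv]
  congr 1
  field_simp

theorem norm_Gamma_mul_Gamma_le {a b : ℂ} (ha : 0 < a.re) (hb : 0 < b.re) :
    ‖Gamma a * Gamma b‖ ≤
      Real.Gamma (a.re + 2) * Real.Gamma b.re * (a.re ^ 2 + a.im ^ 2)⁻¹ := by
  have ha0 : a ≠ 0 := by rintro rfl; simp at ha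
  have ha1 : a + 1 ≠ 0 := by
    intro h
    have := congrArg re h
    simp at this
    linarith
  have hG : Gamma a = Gamma (a + 2) * (a * (a + 1))⁻¹ := by
    rw [show a + 2 = (a + 1) + 1 by ring, Gamma_add_one _ ha1, Gamma_add_one _ ha0]
    field_simp
  have h2 : ‖Gamma (a + 2)‖ ≤ Real.Gamma (a.re + 2) := by
    simpa using norm_Gamma_le_Gamma_re (s := a + 2) (by simp; linarith)
  have hden : a.re ^ 2 + a.im ^ 2 ≤ ‖a * (a + 1)‖ := by
    have h1 : ‖a‖ ≤ ‖a + 1‖ := by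
      rw [← sq_le_sq₀ (norm_nonneg _) (norm_nonneg _), Complex.sq_norm, Complex.sq_norm,
        normSq_apply, normSq_apply]
      simp
      nlinarith
    have h3 : a.re ^ 2 + a.im ^ 2 = ‖a‖ * ‖a‖ := by
      rw [norm_mul_self_eq_normSq, normSq_apply]; ring
    rw [h3, norm_mul]
    gcongr
  have hpos : 0 < a.re ^ 2 + a.im ^ 2 := by positivity
  have hΓ : 0 ≤ Real.Gamma (a.re + 2) := (Real.Gamma_pos_of_pos (by linarith)).le
  calc ‖Gamma a * Gamma b‖ = ‖Gamma (a + 2)‖ * ‖Gamma b‖ * ‖a * (a + 1)‖⁻¹ := by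
        rw [hG, norm_mul, norm_mul, norm_inv]; ring
    _ ≤ _ := by
        gcongr
        exact norm_Gamma_le_Gamma_re hb

theorem continuous_Gamma_vertical {a : ℂ} (ha : 0 < a.re) (c : ℝ) :
    Continuous fun t : ℝ ↦ Gamma (a + ↑(c * t) * I) := by
  refine continuous_iff_continuousAt.2 fun t ↦ ?_
  have hc : ContinuousAt (fun t : ℝ ↦ a + ↑(c * t) * I) t := by fun_prop
  refine ContinuousAt.comp (f := fun t : ℝ ↦ a + ↑(c * t) * I) (g := Gamma)
    (differentiableAt_Gamma _ fun m hm ↦ ?_).continuousAt hc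
  have h := congrArg re hm
  simp at h
  have : (0 : ℝ) ≤ m := m.cast_nonneg
  linarith

theorem integrable_Gamma_mul_Gamma {a b : ℂ} (ha : 0 < a.re) (hb : 0 < b.re) :
    Integrable fun t : ℝ ↦ Gamma (a + t * I) * Gamma (b - t * I) := by
  refine ((integrable_inv_sq_add_sq ha a.im).const_mul
    (Real.Gamma (a.re + 2) * Real.Gamma b.re)).mono' ?_ (.of_forall fun t ↦ ?_)
  · have h := (continuous_Gamma_vertical ha 1).mul (continuous_Gamma_vertical hb (-1))
    refine (h.congr fun t ↦ ?_).aestronglyMeasurable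
    simp [sub_eq_add_neg]
  · simpa [add_comm t] using norm_Gamma_mul_Gamma_le (a := a + t * I) (b := b - t * I)
      (by simpa using ha) (by simpa using hb)

/-- The integrand of the Beta integral after the substitution `x = sigmoid u`. -/
noncomputable def logisticKernel (a b : ℂ) (u : ℝ) : ℂ :=
  (Real.sigmoid u : ℂ) ^ a * (Real.sigmoid (-u) : ℂ) ^ b

theorem continuous_logisticKernel (a b : ℂ) : Continuous (logisticKernel a b) := by
  have h (c : ℂ) : Continuous fun u : ℝ ↦ (Real.sigmoid u : ℂ) ^ c :=
    (continuous_ofReal.comp continuous_sigmoid).cpow continuous_const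
      fun u ↦ ofReal_mem_slitPlane.2 (Real.sigmoid_pos u)
  exact (h a).mul ((h b).comp continuous_neg)

theorem logisticKernel_mul_neg (a b c d : ℂ) (u : ℝ) :
    logisticKernel a b u * logisticKernel c d (-u) = logisticKernel (a + d) (b + c) u := by
  have h (x : ℝ) : (Real.sigmoid x : ℂ) ≠ 0 := ofReal_ne_zero.2 (Real.sigmoid_pos x).ne'
  simp only [logisticKernel, neg_neg, cpow_add _ _ (h _)]
  ring

theorem logisticKernel_add_sub (a b s : ℂ) (u : ℝ) :
    logisticKernel (a + s) (b - s) u = cexp (s * u) * logisticKernel a b u := by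
  have h (x : ℝ) : (Real.sigmoid x : ℂ) ≠ 0 := ofReal_ne_zero.2 (Real.sigmoid_pos x).ne'
  have hs : (Real.sigmoid u : ℂ) ^ s = cexp (s * u) * (Real.sigmoid (-u) : ℂ) ^ s := by
    have hu : Real.sigmoid u = Real.exp u * Real.sigmoid (-u) := by
      simpa [mul_comm] using (Real.sigmoid_mul_rexp_neg (-u)).symm
    rw [hu, ofReal_mul, mul_cpow_ofReal_nonneg (Real.exp_pos u).le (Real.sigmoid_nonneg _),
      cpow_def_of_ne_zero (ofReal_ne_zero.2 (Real.exp_pos u).ne'), ← ofReal_log (Real.exp_pos u).le,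
      Real.log_exp, mul_comm s]
  have h0 : (Real.sigmoid (-u) : ℂ) ^ s ≠ 0 := by simp [cpow_eq_zero_iff, h]
  simp only [logisticKernel, cpow_add _ _ (h _), cpow_sub _ _ (h _), hs]
  field_simp

theorem sigmoid_deriv_smul_eq_logisticKernel (a b : ℂ) (u : ℝ) :
    |Real.sigmoid u * (1 - Real.sigmoid u)| •
      ((Real.sigmoid u : ℂ) ^ (a - 1) * (1 - (Real.sigmoid u : ℂ)) ^ (b - 1)) =
      logisticKernel a b u := by
  have h (x : ℝ) : (Real.sigmoid x : ℂ) ≠ 0 := ofReal_ne_zero.2 (Real.sigmoid_pos x).ne'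
  have h1 : (1 : ℂ) - Real.sigmoid u = Real.sigmoid (-u) := by simp [Real.sigmoid_neg]
  rw [← Real.sigmoid_neg, abs_of_pos (mul_pos (Real.sigmoid_pos _) (Real.sigmoid_pos _)), h1,
    logisticKernel, cpow_sub _ _ (h _), cpow_sub _ _ (h _), real_smul, cpow_one, cpow_one,
    ofReal_mul]
  have := h u
  have := h (-u)
  field_simp

theorem integrable_logisticKernel {a b : ℂ} (ha : 0 < a.re) (hb : 0 < b.re) :
    Integrable (logisticKernel a b) := by
  have h := (intervalIntegrable_iff_integrableOn_Ioo_of_le zero_le_one).1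
    (betaIntegral_convergent ha hb)
  rw [← Real.range_sigmoid, ← Set.image_univ,
    integrableOn_image_iff_integrableOn_abs_deriv_smul MeasurableSet.univ
      (fun x _ ↦ (Real.hasDerivAt_sigmoid x).hasDerivWithinAt)
      Real.sigmoid_injective.injOn] at h
  simpa only [sigmoid_deriv_smul_eq_logisticKernel, integrableOn_univ] using h

theorem betaIntegral_eq_integral_logisticKernel (a b : ℂ) :
    betaIntegral a b = ∫ u, logisticKernel a b u := by
  rw [betaIntegral, intervalIntegral.integral_of_le zero_le_one, integral_Ioc_eq_integral_Ioo,
    ← Real.range_sigmoid, ← Set.image_univ,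
    integral_image_eq_integral_abs_deriv_smul MeasurableSet.univ
      (fun x _ ↦ (Real.hasDerivAt_sigmoid x).hasDerivWithinAt)
      Real.sigmoid_injective.injOn]
  simp only [sigmoid_deriv_smul_eq_logisticKernel, Measure.restrict_univ]

theorem fourier_logisticKernel (a b : ℂ) (ξ : ℝ) :
    𝓕 (logisticKernel a b) ξ =
      betaIntegral (a - ↑(2 * Real.pi * ξ) * I) (b + ↑(2 * Real.pi * ξ) * I) := by
  rw [betaIntegral_eq_integral_logisticKernel, Real.fourier_real_eq_integral_exp_smul]
  congr 1 with u
  have h := logisticKernel_add_sub a b (-(↑(2 * Real.pi * ξ) * I)) u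
  rw [← sub_eq_add_neg, sub_neg_eq_add] at h
  rw [h, smul_eq_mul]
  congr 2
  push_cast
  ring

/-- Parseval's formula in bilinear form. -/
theorem integral_fourier_mul_fourier {f g : ℝ → ℂ} (hf : Integrable f) (hg : Integrable g)
    (hgc : Continuous g) (hFg : Integrable (𝓕 g)) :
    ∫ ξ, 𝓕 f ξ * 𝓕 g ξ = ∫ u, f u * g (-u) := by
  have h := VectorFourier.integral_fourierIntegral_smul_eq_flip (L := innerₗ ℝ) (μ := volume)
    (ν := volume) Real.continuous_fourierChar continuous_inner hf hFg
  have h' : ∫ ξ, 𝓕 f ξ * 𝓕 g ξ = ∫ u, f u * 𝓕 (𝓕 g) u := by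
    simpa using! h
  rw [h']
  congr 1 with u
  have := congrFun (hgc.fourierInv_fourier_eq hg hFg) (-u)
  rw [Real.fourierInv_eq_fourier_neg, neg_neg] at this
  rw [this]

theorem Gamma_mul_Gamma_eq_fourier_logisticKernel {a b : ℂ} (ha : 0 < a.re) (hb : 0 < b.re)
    (ξ : ℝ) :
    Gamma (a + ↑(2 * Real.pi * ξ) * I) * Gamma (b - ↑(2 * Real.pi * ξ) * I) =
      Gamma (a + b) * 𝓕 (logisticKernel b a) ξ := by
  rw [fourier_logisticKernel, mul_comm (Gamma _), Gamma_mul_Gamma_eq_betaIntegral]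
  · congr 2
    ring
  · simpa using hb
  · simpa using ha

theorem integrable_fourier_logisticKernel {a b : ℂ} (ha : 0 < a.re) (hb : 0 < b.re) :
    Integrable (𝓕 (logisticKernel b a)) := by
  have h := ((integrable_Gamma_mul_Gamma ha hb).comp_mul_left'
    (R := 2 * Real.pi) (by positivity)).const_mul (Gamma (a + b))⁻¹
  refine h.congr (.of_forall fun ξ ↦ ?_)
  simp only
  rw [Gamma_mul_Gamma_eq_fourier_logisticKernel ha hb,
    inv_mul_cancel_left₀ (Gamma_ne_zero_of_re_pos (add_pos ha hb))]

theorem integral_Gamma_mul_Gamma_mul_Gamma_mul_Gamma {a b c d : ℂ} (ha : 0 < a.re) (hb : 0 < b.re)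
    (hc : 0 < c.re) (hd : 0 < d.re) :
    ∫ t : ℝ, Gamma (a + t * I) * Gamma (b - t * I) * (Gamma (c + t * I) * Gamma (d - t * I)) =
      2 * Real.pi * (Gamma (a + b) * Gamma (c + d) * betaIntegral (b + c) (a + d)) := by
  have hscale := Measure.integral_comp_mul_left (fun t : ℝ ↦
    Gamma (a + t * I) * Gamma (b - t * I) * (Gamma (c + t * I) * Gamma (d - t * I))) (2 * Real.pi)
  have hparseval := integral_fourier_mul_fourier (integrable_logisticKernel hb ha)
    (integrable_logisticKernel hd hc) (continuous_logisticKernel d c)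
    (integrable_fourier_logisticKernel hc hd)
  simp only [logisticKernel_mul_neg, ← betaIntegral_eq_integral_logisticKernel] at hparseval
  simp only [Gamma_mul_Gamma_eq_fourier_logisticKernel ha hb,
    Gamma_mul_Gamma_eq_fourier_logisticKernel hc hd, mul_mul_mul_comm (Gamma (a + b)),
    integral_const_mul, hparseval] at hscale
  rw [hscale, abs_of_pos (by positivity), real_smul]
  have : (Real.pi : ℂ) ≠ 0 := ofReal_ne_zero.2 Real.pi_ne_zero
  rw [← mul_assoc, ofReal_inv, ofReal_mul, ofReal_ofNat,
    mul_inv_cancel₀ (mul_ne_zero two_ne_zero this), one_mul]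

/-- **First Barnes Lemma.** -/
theorem first_barnes_lemma (α β γ δ : ℂ)
    (σ : ℝ) (hσ₁ : max (-α.re) (-β.re) < σ) (hσ₂ : σ < min γ.re δ.re) :
    (1 / (2 * (Real.pi : ℂ))) *
      ∫ t : ℝ,
        Complex.Gamma (σ + t * I + α) * Complex.Gamma (σ + t * I + β) *
          Complex.Gamma (γ - σ - t * I) * Complex.Gamma (δ - σ - t * I) =
    Complex.Gamma (α + γ) * Complex.Gamma (α + δ) * Complex.Gamma (β + γ) *
      Complex.Gamma (β + δ) / Complex.Gamma (α + β + γ + δ) := by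
  obtain ⟨hα, hβ⟩ := max_lt_iff.1 hσ₁
  obtain ⟨hγ, hδ⟩ := lt_min_iff.1 hσ₂
  have hπ : (Real.pi : ℂ) ≠ 0 := ofReal_ne_zero.2 Real.pi_ne_zero
  have h := integral_Gamma_mul_Gamma_mul_Gamma_mul_Gamma (a := σ + α) (b := γ - σ) (c := σ + β)
    (d := δ - σ) (by simp; linarith) (by simp; linarith) (by simp; linarith) (by simp; linarith)
  have hint : (∫ t : ℝ, Gamma (σ + t * I + α) * Gamma (σ + t * I + β) *
      Gamma (γ - σ - t * I) * Gamma (δ - σ - t * I)) =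
      ∫ t : ℝ, Gamma (σ + α + t * I) * Gamma (γ - σ - t * I) *
        (Gamma (σ + β + t * I) * Gamma (δ - σ - t * I)) := by
    congr 1 with t
    rw [add_right_comm _ _ α, add_right_comm _ _ β]
    ring
  rw [hint, h, betaIntegral_eq_Gamma_mul_div _ _ (by simp; linarith) (by simp; linarith),
    show (σ : ℂ) + α + (γ - σ) = α + γ by ring, show (σ : ℂ) + β + (δ - σ) = β + δ by ring,
    show γ - σ + (σ + β) = β + γ by ring, show (σ : ℂ) + α + (δ - σ) = α + δ by ring,
    show β + γ + (α + δ) = α + β + γ + δ by ring]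
  field_simp
end

section
/- Kontorovich–Lebedev inversion: Fix η > 40 and let H ∈ C_η. Then for every purely imaginary μ (μ = ir with r ∈ ℝ, r ≠ 0) one has ∫₀^∞ H^♭(y) · W_μ(y) · y^{−2} dy = H(μ). -/
open Complex MeasureTheory Set

/-- The K-Bessel function `K_μ(x) = ∫₀^∞ exp(−x cosh t) cosh(μt) dt`. -/
noncomputable def KBessel (μ : ℂ) (x : ℝ) : ℂ :=
  ∫ t in Ioi (0:ℝ), Complex.exp (-(x : ℂ) * (Real.cosh t : ℂ)) * Complex.cosh (μ * (t : ℂ))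

/-- The GL(2) Whittaker function `W_μ(y) = 2√y K_μ(2πy)`. -/
noncomputable def W2 (μ : ℂ) (y : ℝ) : ℂ :=
  2 * (Real.sqrt y : ℂ) * KBessel μ (2 * Real.pi * y)

/-- The class `C_η` of test functions: holomorphic on `|Re μ| < 2η`, even, and with
rapid decay `|H(μ)| ≤ C exp(−2π|Im μ|)` on the strip. -/
def MemCeta (η : ℝ) (H : ℂ → ℂ) : Prop :=
  DifferentiableOn ℂ H {μ : ℂ | |μ.re| < 2 * η} ∧
  (∀ μ : ℂ, |μ.re| < 2 * η → H (-μ) = H μ) ∧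
  ∃ C : ℝ, ∀ μ : ℂ, |μ.re| < 2 * η → ‖H μ‖ ≤ C * Real.exp (-2 * Real.pi * |μ.im|)

/-- The inverse Kontorovich–Lebedev transform
`H^♭(y) := (1/(4π)) ∫_ℝ H(it) W_{it}(y) / (Γ(it)Γ(−it)) dt`. -/
noncomputable def Hflat (H : ℂ → ℂ) (y : ℝ) : ℂ :=
  (1 / (4 * (Real.pi : ℂ))) * ∫ t : ℝ,
    H (t * I) * W2 (t * I) y / (Complex.Gamma (t * I) * Complex.Gamma (-(t * I)))

open Filter Topology

lemma integrable_exp_neg_abs : Integrable fun u : ℝ => Real.exp (-|u|) := by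
  have h1 : IntegrableOn (fun u : ℝ => Real.exp (-|u|)) (Ioi 0) := by
    refine (integrableOn_exp_mul_Ioi (a := -1) (by norm_num) 0).congr_fun ?_ measurableSet_Ioi
    intro u hu
    simp [abs_of_pos (mem_Ioi.mp hu)]
  have h2 : IntegrableOn (fun u : ℝ => Real.exp (-|u|)) (Iic 0) := by
    refine (integrableOn_exp_mul_Iic (a := 1) (by norm_num) 0).congr_fun ?_ measurableSet_Iic
    intro u hu
    simp [abs_of_nonpos (mem_Iic.mp hu)]
  rw [← integrableOn_univ, ← Iic_union_Ioi (a := (0 : ℝ))]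
  exact h2.union h1

lemma exp_abs_div_two_le_cosh (u : ℝ) : Real.exp |u| / 2 ≤ Real.cosh u := by
  rw [← Real.cosh_abs, Real.cosh_eq]
  linarith [Real.exp_pos (-|u|)]

lemma cosh_le_exp_abs (u : ℝ) : Real.cosh u ≤ Real.exp |u| := by
  rw [← Real.cosh_abs, Real.cosh_eq]
  have : Real.exp (-|u|) ≤ Real.exp |u| := Real.exp_le_exp.2 (by linarith [abs_nonneg u])
  linarith

lemma abs_sinh_le_cosh (u : ℝ) : |Real.sinh u| ≤ Real.cosh u := by
  rw [abs_le, Real.cosh_eq, Real.sinh_eq]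
  constructor <;> linarith [Real.exp_pos u, Real.exp_pos (-u)]

lemma inv_cosh_le (u : ℝ) : (Real.cosh u)⁻¹ ≤ 2 * Real.exp (-|u|) := by
  rw [inv_le_comm₀ (Real.cosh_pos u) (by positivity), mul_inv, Real.exp_neg, inv_inv]
  linarith [exp_abs_div_two_le_cosh u]

lemma abs_le_cosh (u : ℝ) : |u| ≤ Real.cosh u := by
  have h := Real.quadratic_le_exp_of_nonneg (abs_nonneg u)
  nlinarith [exp_abs_div_two_le_cosh u, sq_nonneg (|u| - 1)]

lemma sigmoid_deriv_le (w : ℝ) :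
    Real.sigmoid w * (1 - Real.sigmoid w) ≤ Real.exp (-|w|) := by
  have key : ∀ x : ℝ, 0 ≤ x → Real.sigmoid x * (1 - Real.sigmoid x) ≤ Real.exp (-|x|) := by
    intro x hx
    rw [abs_of_nonneg hx, ← Real.sigmoid_neg, ← Real.sigmoid_mul_rexp_neg]
    have h0 := Real.sigmoid_nonneg x
    have h1 := Real.sigmoid_le_one x
    have := Real.exp_pos (-x)
    calc _ = (Real.sigmoid x * Real.sigmoid x) * Real.exp (-x) := by ring
      _ ≤ 1 * Real.exp (-x) := by gcongr; nlinarith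
      _ = _ := one_mul _
  rcases le_total 0 w with h | h
  · exact key w h
  · have := key (-w) (by linarith)
    rw [abs_neg, Real.sigmoid_neg] at this
    linarith

lemma integrable_sigmoid_deriv :
    Integrable fun w : ℝ => ((Real.sigmoid w * (1 - Real.sigmoid w) : ℝ) : ℂ) := by
  refine Integrable.ofReal ?_
  refine integrable_exp_neg_abs.mono' ?_ (ae_of_all _ fun w => ?_)
  · exact (continuous_sigmoid.mul (continuous_const.sub continuous_sigmoid)).aestronglyMeasurable
  · rw [Real.norm_eq_abs, abs_of_nonneg]
    · exact sigmoid_deriv_le w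
    · exact mul_nonneg (Real.sigmoid_nonneg w) (by linarith [Real.sigmoid_le_one w])

lemma MeasureTheory.Integrable.mul_character {f : ℝ → ℂ} (hf : Integrable f) (a : ℝ) :
    Integrable fun u : ℝ => f u * cexp (((a * u : ℝ) : ℂ) * I) := by
  refine hf.mul_bdd (c := 1) (by fun_prop) (ae_of_all _ fun u => ?_)
  rw [norm_exp_ofReal_mul_I]

/-- The Fourier transform of the derivative of the sigmoid function is a Beta integral. -/
lemma integral_sigmoid_deriv_mul_character (t : ℝ) :
    ∫ w : ℝ, ((Real.sigmoid w * (1 - Real.sigmoid w) : ℝ) : ℂ) * cexp (((t * w : ℝ) : ℂ) * I) =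
      Gamma (1 + t * I) * Gamma (1 - t * I) := by
  rw [Gamma_mul_Gamma_eq_betaIntegral (by simp) (by simp)]
  have hG : Gamma (1 + t * I + (1 - t * I)) = 1 := by
    rw [show (1 + t * I + (1 - t * I) : ℂ) = (1 : ℕ) + 1 by push_cast; ring,
      Complex.Gamma_nat_eq_factorial]
    simp
  rw [hG, one_mul, betaIntegral, intervalIntegral.integral_of_le zero_le_one,
    integral_Ioc_eq_integral_Ioo, ← Real.range_sigmoid, ← image_univ,
    integral_image_eq_integral_abs_deriv_smul MeasurableSet.univ
      (fun w _ => (Real.hasDerivAt_sigmoid w).hasDerivWithinAt)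
      Real.sigmoid_injective.injOn, setIntegral_univ]
  refine integral_congr_ae (ae_of_all _ fun w => ?_)
  have h0 := Real.sigmoid_pos w
  have h1 : 0 < 1 - Real.sigmoid w := by linarith [Real.sigmoid_lt_one w]
  have hlog : Real.log (Real.sigmoid w) - Real.log (1 - Real.sigmoid w) = w := by
    rw [← Real.sigmoid_neg, ← Real.sigmoid_mul_rexp_neg, Real.log_mul h0.ne' (Real.exp_pos _).ne',
      Real.log_exp]
    ring
  have e1 : (1 - (Real.sigmoid w : ℂ)) = ((1 - Real.sigmoid w : ℝ) : ℂ) := by push_cast; rfl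
  simp only
  rw [abs_of_pos (mul_pos h0 h1), Complex.real_smul, e1,
    cpow_def_of_ne_zero (by exact_mod_cast h0.ne'), cpow_def_of_ne_zero (by exact_mod_cast h1.ne'),
    ← ofReal_log h0.le, ← ofReal_log h1.le, ← Complex.exp_add]
  congr 2
  conv_lhs => rw [← hlog]
  push_cast
  ring

lemma sigmoid_sub_sigmoid (u v : ℝ) :
    Real.sigmoid (u + v) - Real.sigmoid (u - v) =
      Real.sinh v / (Real.cosh u + Real.cosh v) := by
  have hu := Real.exp_pos u
  have hv := Real.exp_pos v
  rw [Real.sigmoid_def, Real.sigmoid_def, Real.sinh_eq, Real.cosh_eq, Real.cosh_eq, neg_add, neg_sub,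
    Real.exp_add, Real.exp_sub, Real.exp_neg, Real.exp_neg]
  field_simp
  ring

lemma integrable_inv_cosh_add_cosh (v : ℝ) :
    Integrable fun u : ℝ => ((Real.sinh v / (Real.cosh u + Real.cosh v) : ℝ) : ℂ) := by
  suffices h : Integrable fun u : ℝ => (Real.cosh u + Real.cosh v)⁻¹ from
    (h.const_mul (Real.sinh v)).ofReal
  refine (integrable_exp_neg_abs.const_mul 2).mono' ?_ (ae_of_all _ fun u => ?_)
  · refine Continuous.aestronglyMeasurable ?_
    refine Continuous.inv₀ (by fun_prop) fun u => ?_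
    linarith [Real.cosh_pos u, Real.cosh_pos v]
  · have hu := Real.cosh_pos u
    have hv := Real.cosh_pos v
    rw [Real.norm_eq_abs, abs_of_pos (by positivity)]
    refine le_trans ?_ (inv_cosh_le u)
    gcongr
    linarith

lemma integral_sinh_div_mul_character {t : ℝ} (ht : t ≠ 0) (v : ℝ) :
    ∫ u : ℝ, ((Real.sinh v / (Real.cosh u + Real.cosh v) : ℝ) : ℂ) *
        cexp (((t * u : ℝ) : ℂ) * I) =
      (cexp (((t * v : ℝ) : ℂ) * I) - cexp (((t * -v : ℝ) : ℂ) * I)) / (t * I) *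
        (Gamma (1 + t * I) * Gamma (1 - t * I)) := by
  have htI : (t * I : ℂ) ≠ 0 := by simp [ht]
  set D : ℝ → ℂ := fun w => ((Real.sigmoid w * (1 - Real.sigmoid w) : ℝ) : ℂ) with hD
  have hq : ∀ u : ℝ, HasDerivAt
      (fun u : ℝ => ((Real.sinh v / (Real.cosh u + Real.cosh v) : ℝ) : ℂ))
      (D (u + v) - D (u - v)) u := by
    intro u
    have := (((Real.hasDerivAt_sigmoid (u + v)).comp_add_const u v).sub
      ((Real.hasDerivAt_sigmoid (u - v)).comp_sub_const u v)).ofReal_comp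
    refine (this.congr_deriv ?_).congr_of_eventuallyEq (Eventually.of_forall fun x => ?_)
    · simp [hD]
    · simp [← sigmoid_sub_sigmoid]
  have he : ∀ u : ℝ, HasDerivAt (fun u : ℝ => cexp (((t * u : ℝ) : ℂ) * I) / (t * I))
      (cexp (((t * u : ℝ) : ℂ) * I)) u := by
    intro u
    have h := (((hasDerivAt_id u).const_mul t).ofReal_comp.mul_const I).cexp.div_const (t * I)
    refine h.congr_deriv ?_
    rw [mul_one, mul_div_assoc, div_self htI, mul_one, id]
  have hDi : ∀ a : ℝ, Integrable fun u => D (u + a) :=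
    fun a => integrable_sigmoid_deriv.comp_add_right a
  have hDs : ∀ a : ℝ, ∫ u : ℝ, D (u + a) * cexp (((t * u : ℝ) : ℂ) * I) =
      cexp (((t * -a : ℝ) : ℂ) * I) * (Gamma (1 + t * I) * Gamma (1 - t * I)) := by
    intro a
    rw [← integral_sigmoid_deriv_mul_character, ← integral_const_mul,
      ← integral_add_right_eq_self (fun u : ℝ => cexp (((t * -a : ℝ) : ℂ) * I) *
        (((Real.sigmoid u * (1 - Real.sigmoid u) : ℝ) : ℂ) * cexp (((t * u : ℝ) : ℂ) * I))) a]
    refine integral_congr_ae (ae_of_all _ fun u => ?_)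
    simp only [hD]
    rw [mul_left_comm, ← Complex.exp_add]
    congr 2
    push_cast
    ring
  have key := integral_mul_deriv_eq_deriv_mul_of_integrable
    (fun u _ => hq u) (fun u _ => he u)
    ((integrable_inv_cosh_add_cosh v).mul_character t)
    (by
      have := (((hDi v).sub (hDi (-v))).mul_character t).div_const (t * I)
      refine this.congr (ae_of_all _ fun u => ?_)
      simp [sub_eq_add_neg, mul_div_assoc])
    (by
      refine (((integrable_inv_cosh_add_cosh v).mul_character t).div_const (t * I)).congr
        (ae_of_all _ fun u => ?_)
      simp [mul_div_assoc])
  rw [key]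
  have : ∀ u : ℝ, (D (u + v) - D (u - v)) * (cexp (((t * u : ℝ) : ℂ) * I) / (t * I)) =
      (D (u + v) * cexp (((t * u : ℝ) : ℂ) * I) -
        D (u + -v) * cexp (((t * u : ℝ) : ℂ) * I)) / (t * I) := by
    intro u
    rw [sub_eq_add_neg u v]
    ring
  simp only [this]
  rw [integral_div, integral_sub ((hDi v).mul_character t) ((hDi (-v)).mul_character t), hDs, hDs,
    neg_neg]
  ring

/-- The Fourier transform with kernel `exp (i t u)`. -/
noncomputable def charFourier (f : ℝ → ℂ) (u : ℝ) : ℂ :=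
  ∫ t : ℝ, f t * cexp (((u * t : ℝ) : ℂ) * I)

lemma integral_charFourier_mul_character {f : ℝ → ℂ} (hc : Continuous f) (hf : Integrable f)
    (hF : Integrable (charFourier f)) (r : ℝ) :
    ∫ u : ℝ, charFourier f u * cexp (((r * u : ℝ) : ℂ) * I) = 2 * Real.pi * f (-r) := by
  have hpi := Real.pi_pos
  have hfour : ∀ w : ℝ, FourierTransform.fourier f w = charFourier f (-(2 * Real.pi) * w) := by
    intro w
    rw [Real.fourier_real_eq_integral_exp_smul, charFourier]
    refine integral_congr_ae (ae_of_all _ fun t => ?_)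
    simp only [smul_eq_mul]
    rw [mul_comm]
    congr 3
    push_cast
    ring
  have hF' : Integrable (FourierTransform.fourier f) := by
    rw [show FourierTransform.fourier f = fun w => charFourier f (-(2 * Real.pi) * w) from
      funext hfour]
    exact hF.comp_mul_left' (by simp [hpi.ne'])
  have h := congr_fun (hc.fourierInv_fourier_eq hf hF') (-r)
  rw [← h, Real.fourierInv_eq', ← integral_const_mul]
  have h2 := Measure.integral_comp_mul_left
    (fun u : ℝ => charFourier f u * cexp (((r * u : ℝ) : ℂ) * I)) (-(2 * Real.pi))
  have h3 : |(-(2 * Real.pi))⁻¹| = (2 * Real.pi)⁻¹ := by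
    rw [abs_inv, abs_neg, abs_of_pos (by positivity)]
  rw [h3] at h2
  have h4 : ∫ u : ℝ, charFourier f u * cexp (((r * u : ℝ) : ℂ) * I) =
      (2 * Real.pi : ℝ) • ∫ w : ℝ, charFourier f (-(2 * Real.pi) * w) *
        cexp (((r * (-(2 * Real.pi) * w) : ℝ) : ℂ) * I) := by
    rw [h2, smul_smul, mul_inv_cancel₀ (by positivity), one_smul]
  rw [h4, Complex.real_smul, ← integral_const_mul]
  refine integral_congr_ae (ae_of_all _ fun w => ?_)
  simp only [hfour, smul_eq_mul]
  push_cast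
  rw [mul_comm (charFourier _ _)]
  congr 3
  simp
  ring

/-- Shifting a horizontal contour of integration inside a strip of exponential decay. -/
lemma integral_eq_integral_shift {f : ℂ → ℂ} {a : ℝ} {C : ℝ} (ha : 0 ≤ a)
    (hf : DifferentiableOn ℂ f {z | |z.im| ≤ a})
    (hC : ∀ z : ℂ, |z.im| ≤ a → ‖f z‖ ≤ C * Real.exp (-|z.re|)) :
    ∫ t : ℝ, f t = ∫ t : ℝ, f (t + a * I) := by
  have hint : ∀ b : ℝ, |b| ≤ a → Integrable fun t : ℝ => f (t + b * I) := by
    intro b hb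
    refine (integrable_exp_neg_abs.const_mul C).mono' ?_ (ae_of_all _ fun t => ?_)
    · refine Continuous.aestronglyMeasurable ?_
      refine hf.continuousOn.comp_continuous (by fun_prop) fun t => ?_
      simpa using hb
    · simpa using hC (t + b * I) (by simpa using hb)
  have hrect : ∀ R : ℝ, ((∫ x in (-R)..R, f x) - ∫ x in (-R)..R, f (x + a * I)) =
      -(I * ∫ y in (0 : ℝ)..a, f (R + y * I)) + I * ∫ y in (0 : ℝ)..a, f (-R + y * I) := by
    intro R
    have := integral_boundary_rect_eq_zero_of_differentiableOn f (-R : ℂ) (R + a * I) (by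
      refine hf.mono fun z hz => ?_
      have hz2 := hz.2
      simp only [mem_preimage, neg_im, ofReal_im, neg_zero, add_im, mul_im, I_im, mul_one,
        ofReal_re, I_re, mul_zero, add_zero, zero_add, uIcc_of_le ha] at hz2
      simpa [abs_of_nonneg hz2.1] using hz2.2)
    simp at this
    linear_combination this
  have hside : ∀ s : ℝ, |s| = 1 →
      Tendsto (fun R : ℝ => ∫ y in (0 : ℝ)..a, f ((s * R : ℝ) + y * I)) atTop (𝓝 0) := by
    intro s hs
    have hb : ∀ᶠ R : ℝ in atTop, ‖∫ y in (0 : ℝ)..a, f ((s * R : ℝ) + y * I)‖ ≤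
        C * Real.exp (-R) * |a - 0| := by
      filter_upwards [eventually_ge_atTop 0] with R hR
      refine intervalIntegral.norm_integral_le_of_norm_le_const fun y hy => ?_
      rw [uIoc_of_le ha] at hy
      have := hC ((s * R : ℝ) + y * I) (by simpa [abs_of_pos hy.1] using hy.2)
      simpa [abs_mul, hs, abs_of_nonneg hR] using this
    refine squeeze_zero_norm' hb ?_
    have := ((Real.tendsto_exp_neg_atTop_nhds_zero).const_mul C).mul_const |a - 0|
    simpa using this
  have h0 : Integrable fun t : ℝ => f t := by simpa using hint 0 (by simpa using ha)
  have h1 := intervalIntegral_tendsto_integral h0 tendsto_neg_atTop_atBot tendsto_id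
  have h2 := intervalIntegral_tendsto_integral (hint a (abs_of_nonneg ha).le)
    tendsto_neg_atTop_atBot tendsto_id
  have h3 := h1.sub h2
  have h4 : Tendsto (fun R : ℝ => -(I * ∫ y in (0 : ℝ)..a, f (R + y * I)) +
      I * ∫ y in (0 : ℝ)..a, f (-R + y * I)) atTop (𝓝 0) := by
    have e1 := (hside 1 (by simp)).const_mul I
    have e2 := (hside (-1) (by simp)).const_mul I
    simpa using e1.neg.add e2
  have h5 := tendsto_nhds_unique (h3.congr fun R => hrect R) h4
  exact sub_eq_zero.mp h5

/-- Exponential decay of the Fourier transform of a function holomorphic in a strip. -/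
lemma norm_charFourier_le {f : ℂ → ℂ} {C : ℝ}
    (hf : DifferentiableOn ℂ f {z | |z.im| ≤ 2})
    (hC : ∀ z : ℂ, |z.im| ≤ 2 → ‖f z‖ ≤ C * Real.exp (-|z.re|)) :
    ∃ M : ℝ, ∀ u : ℝ, ‖charFourier (fun t => f t) u‖ ≤ M * Real.exp (-(2 * |u|)) := by
  have hpos : ∀ g : ℂ → ℂ, DifferentiableOn ℂ g {z | |z.im| ≤ 2} →
      (∀ z : ℂ, |z.im| ≤ 2 → ‖g z‖ ≤ C * Real.exp (-|z.re|)) → ∀ u : ℝ, 0 ≤ u →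
      ‖charFourier (fun t => g t) u‖ ≤
        (∫ t : ℝ, C * Real.exp (-|t|)) * Real.exp (-(2 * |u|)) := by
    intro g hg hgC u hu
    have hC0 : 0 ≤ C := by simpa using (norm_nonneg _).trans (hgC 0 (by simp))
    have hnorm : ∀ z : ℂ, ‖g z * cexp (u * z * I)‖ = ‖g z‖ * Real.exp (-(u * z.im)) := by
      intro z
      rw [norm_mul, Complex.norm_exp]
      simp
    have hshift := integral_eq_integral_shift (f := fun z => g z * cexp (u * z * I)) (a := 2)
      (C := C * Real.exp (2 * u)) (by norm_num) (by fun_prop) (by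
        intro z hz
        rw [hnorm, mul_right_comm]
        gcongr
        · exact hgC z hz
        · nlinarith [(abs_le.mp hz).1])
    rw [charFourier]
    simp only [ofReal_mul]
    rw [hshift, ← integral_mul_const]
    refine norm_integral_le_of_norm_le
      ((integrable_exp_neg_abs.const_mul C).mul_const _) (ae_of_all _ fun t => ?_)
    rw [hnorm, abs_of_nonneg hu]
    have := hgC (t + (2 : ℝ) * I) (by simp)
    simp only [add_re, ofReal_re, mul_re, I_re, mul_zero, ofReal_im, I_im, mul_one, sub_zero,
      add_zero, add_im, mul_im, zero_add] at this ⊢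
    rw [mul_comm u 2]
    gcongr
  refine ⟨∫ t : ℝ, C * Real.exp (-|t|), fun u => ?_⟩
  rcases le_total 0 u with hu | hu
  · exact hpos f hf hC u hu
  · have h := hpos (fun z => f (-z)) (hf.comp (by fun_prop) fun z hz => by simpa using hz)
      (fun z hz => by simpa using hC (-z) (by simpa using hz)) (-u) (by linarith)
    rw [abs_neg] at h
    convert h using 2
    rw [charFourier, charFourier, ← integral_neg_eq_self]
    simp

lemma integrable_of_holomorphic_strip {f : ℂ → ℂ} {C : ℝ}
    (hf : DifferentiableOn ℂ f {z | |z.im| ≤ 2})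
    (hC : ∀ z : ℂ, |z.im| ≤ 2 → ‖f z‖ ≤ C * Real.exp (-|z.re|)) :
    Continuous (fun t : ℝ => f t) ∧ Integrable (fun t : ℝ => f t) := by
  have hc : Continuous fun t : ℝ => f t :=
    hf.continuousOn.comp_continuous (by fun_prop) fun t => by simp
  refine ⟨hc, (integrable_exp_neg_abs.const_mul C).mono' hc.aestronglyMeasurable
    (ae_of_all _ fun t => ?_)⟩
  simpa using hC t (by simp)

lemma continuous_charFourier {f : ℝ → ℂ} (hf : Integrable f) : Continuous (charFourier f) := by
  refine continuous_of_dominated (F := fun u t => f t * cexp (((u * t : ℝ) : ℂ) * I))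
    (bound := fun t => ‖f t‖) (fun u => ?_)
    (fun u => ae_of_all _ fun t => ?_) hf.norm (ae_of_all _ fun t => by fun_prop)
  · exact hf.aestronglyMeasurable.mul (by fun_prop)
  · rw [norm_mul, norm_exp_ofReal_mul_I, mul_one]

lemma integrable_complex_ofReal {α : Type*} [MeasurableSpace α] {μ : Measure α} {f : α → ℝ}
    (hf : Integrable f μ) : Integrable (fun x => (f x : ℂ)) μ :=
  hf.ofReal

lemma integrable_exp_neg_mul_cosh {x : ℝ} (hx : 0 < x) :
    Integrable fun u : ℝ => Real.exp (-(x * Real.cosh u)) := by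
  refine (integrable_exp_neg_abs.comp_mul_left' hx.ne').mono' (by fun_prop)
    (ae_of_all _ fun u => ?_)
  rw [Real.norm_eq_abs, Real.abs_exp, abs_mul, abs_of_pos hx]
  gcongr
  exact abs_le_cosh u

lemma integrable_sinh_mul_exp_neg_mul_cosh {x : ℝ} (hx : 0 < x) :
    Integrable fun u : ℝ => Real.sinh u * Real.exp (-(x * Real.cosh u)) := by
  refine ((integrable_exp_neg_mul_cosh (half_pos hx)).const_mul (2 / x)).mono' (by fun_prop)
    (ae_of_all _ fun u => ?_)
  rw [norm_mul, Real.norm_eq_abs, Real.norm_eq_abs, Real.abs_exp]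
  have h1 : Real.cosh u ≤ 2 / x * Real.exp (x / 2 * Real.cosh u) := by
    have := Real.add_one_le_exp (x / 2 * Real.cosh u)
    calc Real.cosh u = 2 / x * (x / 2 * Real.cosh u) := by field_simp
      _ ≤ _ := by gcongr; linarith
  calc |Real.sinh u| * Real.exp (-(x * Real.cosh u))
      ≤ 2 / x * Real.exp (x / 2 * Real.cosh u) * Real.exp (-(x * Real.cosh u)) := by
        gcongr
        exact (abs_sinh_le_cosh u).trans h1
    _ = _ := by
        rw [mul_assoc, ← Real.exp_add]
        ring_nf

lemma KBessel_eq_integral {x : ℝ} (hx : 0 < x) (t : ℝ) :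
    KBessel (t * I) x =
      1 / 2 * ∫ u : ℝ, (Real.exp (-(x * Real.cosh u)) : ℂ) * cexp (((t * u : ℝ) : ℂ) * I) := by
  have hint := (integrable_complex_ofReal (integrable_exp_neg_mul_cosh hx)).mul_character t
  have hneg := hint.comp_neg
  rw [← intervalIntegral.integral_Iic_add_Ioi (b := 0) hint.integrableOn hint.integrableOn,
    ← neg_zero, ← integral_comp_neg_Ioi, neg_zero, ← integral_add hneg.integrableOn
    hint.integrableOn, ← integral_const_mul, KBessel]
  refine integral_congr_ae (ae_of_all _ fun u => ?_)
  simp only [Real.cosh_neg]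
  rw [Complex.cosh]
  push_cast
  ring_nf

lemma KBessel_div {x : ℝ} (hx : 0 < x) {r : ℝ} (hr : r ≠ 0) :
    KBessel (r * I) x / x =
      1 / (2 * (r * I)) * ∫ v : ℝ, ((Real.sinh v * Real.exp (-(x * Real.cosh v)) : ℝ) : ℂ) *
        cexp (((r * v : ℝ) : ℂ) * I) := by
  have hrI : (r * I : ℂ) ≠ 0 := by simp [hr]
  have hxC : (x : ℂ) ≠ 0 := by exact_mod_cast hx.ne'
  have h1 : ∀ u : ℝ, HasDerivAt (fun u : ℝ => (Real.exp (-(x * Real.cosh u)) : ℂ))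
      (-(x * ((Real.sinh u * Real.exp (-(x * Real.cosh u)) : ℝ) : ℂ))) u := by
    intro u
    have := (((Real.hasDerivAt_cosh u).const_mul x).fun_neg.exp).ofReal_comp
    refine this.congr_deriv ?_
    push_cast
    ring
  have h2 : ∀ u : ℝ, HasDerivAt (fun u : ℝ => cexp (((r * u : ℝ) : ℂ) * I) / (r * I))
      (cexp (((r * u : ℝ) : ℂ) * I)) u := by
    intro u
    have h := (((hasDerivAt_id u).const_mul r).ofReal_comp.mul_const I).cexp.div_const (r * I)
    refine h.congr_deriv ?_
    rw [mul_one, mul_div_assoc, div_self hrI, mul_one, id]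
  have i1 := (integrable_complex_ofReal (integrable_exp_neg_mul_cosh hx)).mul_character r
  have i2 := (integrable_complex_ofReal (integrable_sinh_mul_exp_neg_mul_cosh hx)).mul_character r
  have key := integral_mul_deriv_eq_deriv_mul_of_integrable
    (fun u _ => h1 u) (fun u _ => h2 u) i1
    (by
      refine (i2.const_mul (-(x / (r * I)))).congr (ae_of_all _ fun u => ?_)
      simp only [Pi.mul_apply]
      ring)
    (by
      refine (i1.div_const (r * I)).congr (ae_of_all _ fun u => ?_)
      simp [mul_div_assoc])
  rw [KBessel_eq_integral hx, key, ← integral_neg, ← integral_const_mul, ← integral_const_mul,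
    ← integral_div]
  refine integral_congr_ae (ae_of_all _ fun u => ?_)
  field_simp

/-- Multiplying a tensor product of integrable functions by a bounded kernel and swapping. -/
lemma integral_swap_of_bounded_kernel {μ ν : Measure ℝ} [SFinite μ] [SFinite ν] {f g : ℝ → ℂ}
    {K : ℝ → ℝ → ℂ}
    (hf : Integrable f μ) (hg : Integrable g ν) (hK : Continuous fun p : ℝ × ℝ => K p.1 p.2)
    (hb : ∀ᵐ p ∂(μ.prod ν), ‖K p.1 p.2‖ ≤ 1) :
    ∫ s, f s * ∫ t, g t * K s t ∂ν ∂μ = ∫ t, g t * ∫ s, f s * K s t ∂μ ∂ν := by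
  have hint : Integrable (fun p : ℝ × ℝ => f p.1 * g p.2 * K p.1 p.2) (μ.prod ν) :=
    (hf.mul_prod hg).mul_bdd (c := 1) hK.aestronglyMeasurable hb
  have h := integral_integral_swap (f := fun s t => f s * g t * K s t) hint
  calc ∫ s, f s * ∫ t, g t * K s t ∂ν ∂μ = ∫ s, ∫ t, f s * g t * K s t ∂ν ∂μ := by
        simp only [← integral_const_mul, mul_assoc]
    _ = ∫ t, ∫ s, f s * g t * K s t ∂μ ∂ν := h
    _ = _ := by
        simp only [← integral_const_mul]
        congr! 4
        ring

lemma integral_mul_KBessel {g : ℝ → ℂ} (hg : Integrable g) {x : ℝ} (hx : 0 < x) :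
    ∫ t : ℝ, g t * KBessel (t * I) x =
      1 / 2 * ∫ u : ℝ, (Real.exp (-(x * Real.cosh u)) : ℂ) * charFourier g u := by
  simp only [charFourier]
  rw [integral_swap_of_bounded_kernel (K := fun u t => cexp (((u * t : ℝ) : ℂ) * I))
    (integrable_complex_ofReal (integrable_exp_neg_mul_cosh hx)) hg (by fun_prop)
    (ae_of_all _ fun p => (norm_exp_ofReal_mul_I _).le), ← integral_const_mul]
  refine integral_congr_ae (ae_of_all _ fun t => ?_)
  simp only [KBessel_eq_integral hx, mul_comm t]
  exact mul_left_comm _ _ _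

lemma integrable_charFourier {g : ℝ → ℂ} (hg : Integrable g) {M : ℝ}
    (hM : ∀ u : ℝ, ‖charFourier g u‖ ≤ M * Real.exp (-(2 * |u|))) :
    Integrable (charFourier g) := by
  have h := (integrable_exp_neg_abs.comp_mul_left' (two_ne_zero' ℝ)).const_mul M
  refine h.mono' (continuous_charFourier hg).aestronglyMeasurable (ae_of_all _ fun u => ?_)
  simpa [abs_mul] using hM u

/-- A vanishing density at `0` makes the superposition of Bessel functions small at `0`. -/
lemma norm_integral_mul_KBessel_le {g : ℝ → ℂ} (hc : Continuous g) (hg : Integrable g)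
    (h0 : g 0 = 0) {M : ℝ} (hM : ∀ u : ℝ, ‖charFourier g u‖ ≤ M * Real.exp (-(2 * |u|))) :
    ∃ B : ℝ, ∀ x : ℝ, 0 < x → ‖∫ t : ℝ, g t * KBessel (t * I) x‖ ≤ B * x := by
  have hF := integrable_charFourier hg hM
  have hz : ∫ u : ℝ, charFourier g u = 0 := by
    have := integral_charFourier_mul_character hc hg hF 0
    simpa [h0] using this
  have hM0 : 0 ≤ M := by simpa using (norm_nonneg _).trans (hM 0)
  refine ⟨1 / 2 * ∫ u : ℝ, M * Real.exp (-|u|), fun x hx => ?_⟩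
  have hi : Integrable fun u : ℝ => (Real.exp (-(x * Real.cosh u)) : ℂ) * charFourier g u := by
    refine hF.bdd_mul (c := 1) (by fun_prop) (ae_of_all _ fun u => ?_)
    rw [norm_real, Real.norm_eq_abs, Real.abs_exp, Real.exp_le_one_iff]
    have := Real.cosh_pos u
    nlinarith
  have e : ∫ u : ℝ, (Real.exp (-(x * Real.cosh u)) : ℂ) * charFourier g u =
      ∫ u : ℝ, ((Real.exp (-(x * Real.cosh u)) : ℂ) - 1) * charFourier g u := by
    simp only [sub_mul, one_mul]
    rw [integral_sub hi hF, hz, sub_zero]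
  rw [integral_mul_KBessel hg hx, e, norm_mul, mul_assoc, ← integral_mul_const]
  have hhalf : ‖(1 / 2 : ℂ)‖ = 1 / 2 := by simp
  rw [hhalf]
  gcongr
  refine norm_integral_le_of_norm_le ((integrable_exp_neg_abs.const_mul M).mul_const x)
    (ae_of_all _ fun u => ?_)
  have hcu := Real.cosh_pos u
  have h1 : ‖(Real.exp (-(x * Real.cosh u)) : ℂ) - 1‖ ≤ x * Real.exp |u| := by
    rw [← ofReal_one, ← ofReal_sub, norm_real, Real.norm_eq_abs, abs_sub_comm, abs_of_nonneg]
    · calc 1 - Real.exp (-(x * Real.cosh u)) ≤ x * Real.cosh u := by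
            linarith [Real.add_one_le_exp (-(x * Real.cosh u))]
        _ ≤ _ := by gcongr; exact cosh_le_exp_abs u
    · rw [sub_nonneg, Real.exp_le_one_iff]
      nlinarith
  calc _ = ‖(Real.exp (-(x * Real.cosh u)) : ℂ) - 1‖ * ‖charFourier g u‖ := norm_mul _ _
    _ ≤ (x * Real.exp |u|) * (M * Real.exp (-(2 * |u|))) := by gcongr; exact hM u
    _ = M * (Real.exp |u| * Real.exp (-(2 * |u|))) * x := by ring
    _ = _ := by rw [← Real.exp_add]; ring_nf

lemma integrable_exp_neg_mul_Ioi {c : ℝ} (hc : 0 < c) :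
    Integrable (fun x : ℝ => Real.exp (-(x * c))) (volume.restrict (Ioi 0)) := by
  have := integrableOn_exp_mul_Ioi (a := -c) (by linarith) 0
  refine this.congr (ae_of_all _ fun x => ?_)
  simp only
  ring_nf

lemma sinh_mul_laplace {g : ℝ → ℂ} (hg : Integrable g) (hF : Integrable (charFourier g)) (v : ℝ) :
    Real.sinh v * ∫ x in Ioi (0 : ℝ), (∫ t : ℝ, g t * KBessel (t * I) x) *
        (Real.exp (-(x * Real.cosh v)) : ℂ) =
      1 / 2 * ∫ t : ℝ, g t * ∫ u : ℝ, ((Real.sinh v / (Real.cosh u + Real.cosh v) : ℝ) : ℂ) *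
        cexp (((t * u : ℝ) : ℂ) * I) := by
  have h1 : ∫ x in Ioi (0 : ℝ), (∫ t : ℝ, g t * KBessel (t * I) x) *
        (Real.exp (-(x * Real.cosh v)) : ℂ) =
      1 / 2 * ∫ x in Ioi (0 : ℝ), (Real.exp (-(x * Real.cosh v)) : ℂ) *
        ∫ u : ℝ, charFourier g u * (Real.exp (-(x * Real.cosh u)) : ℂ) := by
    rw [← integral_const_mul]
    refine setIntegral_congr_fun measurableSet_Ioi fun x hx => ?_
    simp only [integral_mul_KBessel hg hx, mul_comm (charFourier g _)]
    ring
  have h2 := integral_swap_of_bounded_kernel (μ := volume.restrict (Ioi 0))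
    (K := fun x u => (Real.exp (-(x * Real.cosh u)) : ℂ))
    (integrable_complex_ofReal (integrable_exp_neg_mul_Ioi (Real.cosh_pos v))) hF (by fun_prop) (by
      have : ∀ᵐ p ∂((volume.restrict (Ioi (0 : ℝ))).prod (volume : Measure ℝ)), p.1 ∈ Ioi (0 : ℝ) :=
        Measure.quasiMeasurePreserving_fst.ae (ae_restrict_mem measurableSet_Ioi)
      filter_upwards [this] with p hp
      rw [norm_real, Real.norm_eq_abs, Real.abs_exp, Real.exp_le_one_iff]
      have := Real.cosh_pos p.2
      have := mem_Ioi.mp hp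
      rw [neg_nonpos]
      positivity)
  have h3 : ∀ u : ℝ, ∫ x in Ioi (0 : ℝ), ((Real.exp (-(x * Real.cosh v)) : ℝ) : ℂ) *
      (Real.exp (-(x * Real.cosh u)) : ℂ) = ((1 / (Real.cosh u + Real.cosh v) : ℝ) : ℂ) := by
    intro u
    have hpos : 0 < Real.cosh u + Real.cosh v := add_pos (Real.cosh_pos u) (Real.cosh_pos v)
    have := integral_exp_mul_Ioi (a := -(Real.cosh u + Real.cosh v)) (by linarith) 0
    rw [mul_zero, Real.exp_zero, neg_div_neg_eq] at this
    rw [← this, ← integral_complex_ofReal]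
    refine integral_congr_ae (ae_of_all _ fun x => ?_)
    simp only [← ofReal_mul, ← Real.exp_add]
    congr 2
    ring
  have h4 := integral_swap_of_bounded_kernel (K := fun u t => cexp (((t * u : ℝ) : ℂ) * I))
    (integrable_inv_cosh_add_cosh v) hg (by fun_prop)
    (ae_of_all _ fun p => (norm_exp_ofReal_mul_I _).le)
  rw [← h4, h1, h2]
  simp only [h3]
  rw [mul_left_comm, ← integral_const_mul]
  congr 2 with u
  simp only [charFourier, mul_comm u]
  push_cast
  ring

lemma integral_mul_exp_neg_mul_Ioi {c : ℝ} (hc : 0 < c) :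
    ∫ x in Ioi (0 : ℝ), x * Real.exp (-(x * c)) = 1 / c ^ 2 := by
  have h := Real.integral_rpow_mul_exp_neg_mul_Ioi (a := 2) (r := c) (by norm_num) hc
  rw [Real.Gamma_two, mul_one, Real.rpow_two] at h
  rw [← one_div_pow, ← h]
  refine setIntegral_congr_fun measurableSet_Ioi fun x _ => ?_
  norm_num [mul_comm x c]

lemma integrable_mul_cosh_mul_exp :
    Integrable (fun p : ℝ × ℝ => p.1 * Real.exp (-(p.1 * Real.cosh p.2)) * Real.cosh p.2)
      ((volume.restrict (Ioi 0)).prod volume) := by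
  rw [integrable_prod_iff' (by fun_prop)]
  have hI := fun v : ℝ => integral_mul_exp_neg_mul_Ioi (Real.cosh_pos v)
  constructor
  · refine ae_of_all _ fun v => ?_
    have hv := Real.cosh_pos v
    have hne : ∫ x in Ioi (0 : ℝ), x * Real.exp (-(x * Real.cosh v)) ≠ 0 := by
      rw [hI]
      positivity
    exact (Integrable.of_integral_ne_zero hne).mul_const (Real.cosh v)
  · refine (integrable_exp_neg_abs.const_mul 2).mono' ?_ (ae_of_all _ fun v => ?_)
    · exact (StronglyMeasurable.integral_prod_left
        (f := fun (x v : ℝ) => ‖x * Real.exp (-(x * Real.cosh v)) * Real.cosh v‖)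
        (by fun_prop)).aestronglyMeasurable
    · have hv := Real.cosh_pos v
      have : ∫ x in Ioi (0 : ℝ), ‖x * Real.exp (-(x * Real.cosh v)) * Real.cosh v‖ =
          (Real.cosh v)⁻¹ := by
        calc _ = ∫ x in Ioi (0 : ℝ), x * Real.exp (-(x * Real.cosh v)) * Real.cosh v := by
              refine setIntegral_congr_fun measurableSet_Ioi fun x hx => ?_
              have := mem_Ioi.mp hx
              exact Real.norm_of_nonneg (by positivity)
          _ = _ := by
              rw [integral_mul_const, hI]
              field_simp
      rw [this, Real.norm_of_nonneg (by positivity)]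
      exact inv_cosh_le v

lemma integral_mul_KBessel_div {F : ℝ → ℂ}
    (hF : AEStronglyMeasurable F (volume.restrict (Ioi 0))) {B : ℝ}
    (hB : ∀ x : ℝ, 0 < x → ‖F x‖ ≤ B * x) {r : ℝ} (hr : r ≠ 0) :
    ∫ x in Ioi (0 : ℝ), F x * (KBessel (r * I) x / x) =
      1 / (2 * (r * I)) * ∫ v : ℝ, (Real.sinh v * ∫ x in Ioi (0 : ℝ), F x *
        (Real.exp (-(x * Real.cosh v)) : ℂ)) * cexp (((r * v : ℝ) : ℂ) * I) := by
  have hint : Integrable (fun p : ℝ × ℝ => F p.1 *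
      (((Real.sinh p.2 * Real.exp (-(p.1 * Real.cosh p.2)) : ℝ) : ℂ) *
        cexp (((r * p.2 : ℝ) : ℂ) * I))) ((volume.restrict (Ioi 0)).prod volume) := by
    refine (integrable_mul_cosh_mul_exp.const_mul B).mono' ?_ ?_
    · exact hF.comp_fst.mul (Continuous.aestronglyMeasurable (by fun_prop))
    · have : ∀ᵐ p ∂((volume.restrict (Ioi (0 : ℝ))).prod (volume : Measure ℝ)), p.1 ∈ Ioi (0 : ℝ) :=
        Measure.quasiMeasurePreserving_fst.ae (ae_restrict_mem measurableSet_Ioi)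
      filter_upwards [this] with p hp
      rw [norm_mul, norm_mul, norm_exp_ofReal_mul_I, mul_one, norm_real, norm_mul,
        Real.norm_eq_abs, Real.norm_eq_abs, Real.abs_exp]
      calc _ ≤ (B * p.1) * (Real.cosh p.2 * Real.exp (-(p.1 * Real.cosh p.2))) := by
            gcongr
            · exact (norm_nonneg _).trans (hB _ hp)
            · exact hB _ hp
            · exact abs_sinh_le_cosh _
        _ = _ := by ring
  calc _ = ∫ x in Ioi (0 : ℝ), 1 / (2 * (r * I)) * ∫ v : ℝ, F x *
        (((Real.sinh v * Real.exp (-(x * Real.cosh v)) : ℝ) : ℂ) *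
          cexp (((r * v : ℝ) : ℂ) * I)) := by
        refine setIntegral_congr_fun measurableSet_Ioi fun x hx => ?_
        rw [KBessel_div hx hr, integral_const_mul]
        ring
    _ = _ := by
        rw [integral_const_mul, integral_integral_swap hint]
        congr 2 with v
        rw [← integral_const_mul, ← integral_mul_const]
        congr 1 with x
        push_cast
        ring

lemma aestronglyMeasurable_integral_mul_KBessel {g : ℝ → ℂ} (hg : Integrable g) :
    AEStronglyMeasurable (fun x : ℝ => ∫ t : ℝ, g t * KBessel (t * I) x)
      (volume.restrict (Ioi 0)) := by
  have hm : StronglyMeasurable fun x : ℝ =>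
      ∫ u : ℝ, (Real.exp (-(x * Real.cosh u)) : ℂ) * charFourier g u := by
    have hc := continuous_charFourier hg
    refine StronglyMeasurable.integral_prod_right
      (f := fun (x u : ℝ) => (Real.exp (-(x * Real.cosh u)) : ℂ) * charFourier g u) ?_
    exact Continuous.stronglyMeasurable (by fun_prop)
  refine (hm.const_mul (1 / 2)).aestronglyMeasurable.congr ?_
  filter_upwards [ae_restrict_mem measurableSet_Ioi] with x hx
  exact (integral_mul_KBessel hg hx).symm

lemma norm_sin_le_exp (z : ℂ) : ‖Complex.sin z‖ ≤ Real.exp |z.im| := by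
  rw [Complex.sin, norm_div, norm_mul, norm_I, mul_one, Complex.norm_ofNat]
  have h := norm_sub_le (cexp (-z * I)) (cexp (z * I))
  rw [Complex.norm_exp, Complex.norm_exp] at h
  have h1 : Real.exp (-z * I).re ≤ Real.exp |z.im| :=
    Real.exp_le_exp.2 (by simpa using le_abs_self z.im)
  have h2 : Real.exp (z * I).re ≤ Real.exp |z.im| :=
    Real.exp_le_exp.2 (by simpa using neg_le_abs z.im)
  linarith

lemma inv_Gamma_mul_Gamma_neg (s : ℂ) :
    (Gamma s * Gamma (-s))⁻¹ = -(s * Complex.sin (Real.pi * s)) / Real.pi := by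
  rcases eq_or_ne s 0 with rfl | hs
  · simp [Complex.Gamma_zero]
  have hpi : (Real.pi : ℂ) ≠ 0 := by exact_mod_cast Real.pi_ne_zero
  have h1 := Complex.Gamma_mul_Gamma_one_sub s
  rw [show 1 - s = -s + 1 by ring, Complex.Gamma_add_one _ (neg_ne_zero.2 hs)] at h1
  have h2 : Gamma s * Gamma (-s) = (-(s * Complex.sin (Real.pi * s)) / Real.pi)⁻¹ := by
    rw [inv_div]
    have : Gamma s * Gamma (-s) = (Gamma s * (-s * Gamma (-s))) / (-s) := by
      field_simp
    rw [this, h1, div_div]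
    congr 1
    ring
  rw [h2, inv_inv]

/-- The holomorphic extension of `t ↦ H (it) / (Γ(it) Γ(-it))` to a strip. -/
lemma spectral_density_bound {η : ℝ} (hη : 40 < η) {H : ℂ → ℂ} (hH : MemCeta η H) :
    ∃ C : ℝ,
      (DifferentiableOn ℂ (fun z : ℂ => z * H (z * I)) {z | |z.im| ≤ 2} ∧
        ∀ z : ℂ, |z.im| ≤ 2 → ‖z * H (z * I)‖ ≤ C * Real.exp (-|z.re|)) ∧
      (DifferentiableOn ℂ (fun z : ℂ => H (z * I) *
          (-(z * I * Complex.sin (Real.pi * (z * I))) / Real.pi)) {z | |z.im| ≤ 2} ∧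
        ∀ z : ℂ, |z.im| ≤ 2 → ‖H (z * I) * (-(z * I * Complex.sin (Real.pi * (z * I))) / Real.pi)‖
          ≤ C * Real.exp (-|z.re|)) := by
  obtain ⟨hd, -, C, hC⟩ := hH
  have hpi := Real.pi_gt_three
  have hmem : ∀ z : ℂ, |z.im| ≤ 2 → |(z * I).re| < 2 * η := by
    intro z hz
    simp only [mul_re, I_re, mul_zero, I_im, mul_one, zero_sub, abs_neg]
    linarith
  have hHd : DifferentiableOn ℂ (fun z : ℂ => H (z * I)) {z | |z.im| ≤ 2} :=
    hd.comp (by fun_prop) fun z hz => hmem z hz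
  have hHb : ∀ z : ℂ, |z.im| ≤ 2 → ‖H (z * I)‖ ≤ C * Real.exp (-2 * Real.pi * |z.re|) := by
    intro z hz
    simpa using hC (z * I) (hmem z hz)
  have hC0 : 0 ≤ C := by simpa using (norm_nonneg _).trans (hHb 0 (by simp))
  have hz2 : ∀ z : ℂ, |z.im| ≤ 2 → ‖z‖ ≤ 2 * Real.exp |z.re| := by
    intro z hz
    have := Complex.norm_le_abs_re_add_abs_im z
    linarith [Real.add_one_le_exp |z.re|, abs_nonneg z.re]
  refine ⟨2 * C, ⟨differentiableOn_id.mul hHd, fun z hz => ?_⟩,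
    hHd.mul (by fun_prop), fun z hz => ?_⟩
  · rw [norm_mul]
    calc ‖z‖ * ‖H (z * I)‖
        ≤ 2 * Real.exp |z.re| * (C * Real.exp (-2 * Real.pi * |z.re|)) := by
          gcongr
          exacts [hz2 z hz, hHb z hz]
      _ = 2 * C * Real.exp (|z.re| + -2 * Real.pi * |z.re|) := by rw [Real.exp_add]; ring
      _ ≤ _ := by
          gcongr
          nlinarith [abs_nonneg z.re]
  · have hs : ‖Complex.sin (Real.pi * (z * I))‖ ≤ Real.exp (Real.pi * |z.re|) := by
      simpa [abs_mul, abs_of_pos Real.pi_pos] using norm_sin_le_exp (Real.pi * (z * I))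
    rw [norm_mul, norm_div, norm_neg, norm_mul, norm_mul, norm_I, mul_one, norm_real,
      Real.norm_of_nonneg Real.pi_pos.le]
    calc ‖H (z * I)‖ * (‖z‖ * ‖Complex.sin (Real.pi * (z * I))‖ / Real.pi)
        ≤ C * Real.exp (-2 * Real.pi * |z.re|) *
          (2 * Real.exp |z.re| * Real.exp (Real.pi * |z.re|) / 1) := by
          gcongr
          exacts [hHb z hz, hz2 z hz, by linarith]
      _ = 2 * C * Real.exp (-2 * Real.pi * |z.re| + |z.re| + Real.pi * |z.re|) := by
          rw [Real.exp_add, Real.exp_add]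
          ring
      _ ≤ _ := by
          gcongr
          nlinarith [abs_nonneg z.re]

lemma charFourier_neg_of_odd {f : ℝ → ℂ} (hf : ∀ t, f (-t) = -f t) (u : ℝ) :
    charFourier f (-u) = -charFourier f u := by
  rw [charFourier, charFourier, ← integral_neg_eq_self, ← integral_neg]
  simp [hf]

/-- The Fourier transform of the kernel cancels the Gamma factors. -/
lemma integral_density_mul_kernel {h : ℝ → ℂ} (heven : ∀ t, h (-t) = h t)
    (hk : Integrable fun t : ℝ => t * h t) (v : ℝ) :
    ∫ t : ℝ, h t * (Gamma (t * I) * Gamma (-(t * I)))⁻¹ *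
        ∫ u : ℝ, ((Real.sinh v / (Real.cosh u + Real.cosh v) : ℝ) : ℂ) *
          cexp (((t * u : ℝ) : ℂ) * I) =
      -2 * I * charFourier (fun t => t * h t) v := by
  have h1 : ∀ t : ℝ, t ≠ 0 → h t * (Gamma (t * I) * Gamma (-(t * I)))⁻¹ *
        ∫ u : ℝ, ((Real.sinh v / (Real.cosh u + Real.cosh v) : ℝ) : ℂ) *
          cexp (((t * u : ℝ) : ℂ) * I) =
      -I * (t * h t * cexp (((v * t : ℝ) : ℂ) * I) - t * h t * cexp (((-v * t : ℝ) : ℂ) * I)) := by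
    intro t ht
    have hs : (t * I : ℂ) ≠ 0 := by simp [ht]
    have hGne : ∀ s : ℂ, s.re = 0 → s ≠ 0 → Gamma s ≠ 0 := by
      intro s hre hs0
      refine Complex.Gamma_ne_zero fun m hm => hs0 ?_
      have : (m : ℝ) = 0 := by simpa [hre] using (congrArg Complex.re hm).symm
      simp [hm, Nat.cast_eq_zero.1 this]
    have hG1 := hGne (t * I) (by simp) hs
    have hG2 := hGne (-(t * I)) (by simp) (neg_ne_zero.2 hs)
    rw [integral_sinh_div_mul_character ht, add_comm, Complex.Gamma_add_one _ hs,
      show (1 - t * I : ℂ) = -(t * I) + 1 by ring, Complex.Gamma_add_one _ (neg_ne_zero.2 hs),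
      mul_comm v, neg_mul_comm, mul_comm (-v)]
    field_simp
  have h2 : ∀ᵐ t : ℝ, t ≠ 0 := by
    simp [ae_iff]
  rw [integral_congr_ae (h2.mono h1), integral_const_mul,
    integral_sub (hk.mul_character v) (hk.mul_character (-v))]
  change -I * (charFourier _ v - charFourier _ (-v)) = _
  rw [charFourier_neg_of_odd (by simp [heven])]
  ring

/-- Kontorovich–Lebedev inversion: for `H ∈ C_η` and purely imaginary `μ = ir`, `r ≠ 0`,
one has `∫₀^∞ H^♭(y) W_μ(y) y^{−2} dy = H(μ)`. -/
theorem kontorovich_lebedev_inversion (η : ℝ) (hη : 40 < η) (H : ℂ → ℂ) (hH : MemCeta η H)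
    (r : ℝ) (hr : r ≠ 0) :
    ∫ y in Ioi (0:ℝ), Hflat H y * W2 (r * I) y / ((y : ℂ) ^ 2) = H (r * I) := by
  have hpi := Real.pi_pos
  have hpiC : (Real.pi : ℂ) ≠ 0 := by exact_mod_cast hpi.ne'
  have hrC : (r : ℂ) ≠ 0 := by exact_mod_cast hr
  obtain ⟨C, ⟨hkd, hkb⟩, hgd, hgb⟩ := spectral_density_bound hη hH
  obtain ⟨hkc, hki⟩ := integrable_of_holomorphic_strip hkd hkb
  obtain ⟨hgc, hgi⟩ := integrable_of_holomorphic_strip hgd hgb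
  obtain ⟨Mk, hMk⟩ := norm_charFourier_le hkd hkb
  obtain ⟨Mg, hMg⟩ := norm_charFourier_le hgd hgb
  simp only [← inv_Gamma_mul_Gamma_neg] at hgc hgi hMg
  set g : ℝ → ℂ := fun t => H (t * I) * (Gamma (t * I) * Gamma (-(t * I)))⁻¹ with hg
  set F : ℝ → ℂ := fun x => ∫ t : ℝ, g t * KBessel (t * I) x with hF
  obtain ⟨B, hB⟩ := norm_integral_mul_KBessel_le hgc hgi (by simp [hg, Complex.Gamma_zero]) hMg
  have heven : ∀ t : ℝ, H ((-t : ℝ) * I) = H (t * I) := by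
    intro t
    have := hH.2.1 (t * I) (by simp; linarith)
    simpa using this
  have hS : ∀ v : ℝ, Real.sinh v * ∫ x in Ioi (0 : ℝ), F x * (Real.exp (-(x * Real.cosh v)) : ℂ) =
      -I * charFourier (fun t => t * H (t * I)) v := by
    intro v
    rw [sinh_mul_laplace hgi (integrable_charFourier hgi hMg),
      integral_density_mul_kernel (h := fun t => H (t * I)) heven hki]
    ring
  have hA : ∫ x in Ioi (0 : ℝ), F x * (KBessel (r * I) x / x) = Real.pi * H (r * I) := by
    rw [integral_mul_KBessel_div (F := F) (aestronglyMeasurable_integral_mul_KBessel hgi) hB hr]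
    simp only [hS, mul_assoc]
    rw [integral_const_mul,
      integral_charFourier_mul_character hkc hki (integrable_charFourier hki hMk), heven]
    push_cast
    field_simp
  have hflat : ∀ y : ℝ, Hflat H y = 1 / (4 * Real.pi) * (2 * Real.sqrt y) *
      F (2 * Real.pi * y) := by
    intro y
    rw [Hflat, hF, mul_assoc, ← integral_const_mul (2 * (Real.sqrt y : ℂ))]
    congr 2 with t
    simp only [hg, W2, div_eq_mul_inv]
    ring
  have hsub := integral_comp_mul_left_Ioi (fun x : ℝ => F x * (KBessel (r * I) x / x)) 0
    (b := 2 * Real.pi) (by positivity)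
  rw [mul_zero, hA] at hsub
  calc _ = ∫ y in Ioi (0 : ℝ), 2 * (F (2 * Real.pi * y) *
        (KBessel (r * I) (2 * Real.pi * y) / (2 * Real.pi * y : ℝ))) := by
        refine setIntegral_congr_fun measurableSet_Ioi fun y hy => ?_
        have hy0 : (y : ℂ) ≠ 0 := by exact_mod_cast (mem_Ioi.mp hy).ne'
        have hsq : (Real.sqrt y : ℂ) ^ 2 = y := by
          exact_mod_cast Real.sq_sqrt (mem_Ioi.mp hy).le
        simp only [hflat, W2]
        push_cast
        field_simp
        rw [hsq]
        ring
    _ = _ := by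
        rw [integral_const_mul, hsub, Complex.real_smul]
        push_cast
        field_simp
end
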